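/- arXiv:2407.05768 — 10 statements merged into one kernel-verified Lean document; each statement's English description precedes it below -/
import Mathlib

section
/- For every integer n ≥ 0, the Vandermonde-type determinant det(q^{ij})_{i,j=0}^{n-1} (an n×n determinant with entries q^{ij}) equals q^{C(n,3)} (q−1)^{C(n,2)} ∏_{j=0}^{n−1} [j]_q!, where C(n,3) = n(n−1)(n−2)/6 and C(n,2) = n(n−1)/2. -/
open Polynomial Finset

noncomputable section

/-- `C2 m` is the binomial coefficient `C(m,2) = m(m-1)/2` for `m : ℤ`
(a nonnegative integer for every integer `m`). -/
def C2 (m : ℤ) : ℕ := (m * (m - 1) / 2).toNat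

/-- The q-integer `[n]_q = 1 + q + ⋯ + q^{n-1}` in `ℤ[q]` (with `q = X`). -/
def qInt (n : ℕ) : Polynomial ℤ := ∑ i ∈ Finset.range n, X ^ i

/-- The q-factorial `[n]_q! = [1]_q [2]_q ⋯ [n]_q`, with `[0]_q! = 1`. -/
def qFact : ℕ → Polynomial ℤ
  | 0 => 1
  | n + 1 => qFact n * qInt (n + 1)

/-- `a(n,q) = q^{C(n,2)}` for `n ≥ 0` and `a(n,q) = 0` for `n < 0`. -/
def a (m : ℤ) : Polynomial ℤ := if m < 0 then 0 else X ^ C2 m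

/-- The Hankel determinant `d_{m,n}(q) = det(q^{C(m+i+j,2)})_{i,j=0}^{n-1}`. -/
def dd (m : ℤ) (n : ℕ) : Polynomial ℤ :=
  Matrix.det (Matrix.of fun i j : Fin n => (X : Polynomial ℤ) ^ C2 (m + (i : ℤ) + (j : ℤ)))

/-- The Hankel determinant `D_{m,n}(q) = det(a(m+i+j,q))_{i,j=0}^{n-1}`. -/
def DD (m : ℤ) (n : ℕ) : Polynomial ℤ :=
  Matrix.det (Matrix.of fun i j : Fin n => a (m + (i : ℤ) + (j : ℤ)))

/-- `v_{k,n}(q) = det(a(k-n+i+j,q))_{i,j=0}^{n-1}`. -/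
def vv (k : ℤ) (n : ℕ) : Polynomial ℤ :=
  Matrix.det (Matrix.of fun i j : Fin n => a (k - (n : ℤ) + (i : ℤ) + (j : ℤ)))

/-- `r_{1,n}(q) = q^{C(n+2,2)} - (q-1)^{n+1} [n+1]_q!`. -/
def r1 (n : ℕ) : Polynomial ℤ := X ^ ((n + 2).choose 2) - (X - 1) ^ (n + 1) * qFact (n + 1)

/-- `r_{2,n}(q)`, defined by `r_{2,0} = 1` and
`r_{2,n} = r_{1,n}^2 + (q^{n+1}-1) q^{n+2} r_{2,n-1}` for `n ≥ 1`. -/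
def r2 : ℕ → Polynomial ℤ
  | 0 => 1
  | n + 1 => (r1 (n + 1)) ^ 2 + (X ^ (n + 2) - 1) * X ^ (n + 3) * r2 n

theorem X_sub_one_mul_qInt (n : ℕ) : (X - 1) * qInt n = X ^ n - 1 := by
  rw [qInt, mul_comm, geom_sum_mul]

theorem prod_range_X_pow_sub_X_pow (n : ℕ) :
    ∏ i ∈ Finset.range n, ((X : Polynomial ℤ) ^ n - X ^ i) =
      X ^ (n.choose 2) * (X - 1) ^ n * qFact n := by
  induction n with
  | zero => simp [qFact]
  | succ n ih =>
    have shift (i : ℕ) : (X : Polynomial ℤ) ^ (n + 1) - X ^ (i + 1) = X * (X ^ n - X ^ i) := by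
      ring
    have hchoose : (n + 1).choose 2 = n + n.choose 2 := by
      rw [Nat.choose_succ_succ' n 1, Nat.choose_one_right]
    rw [Finset.prod_range_succ', Finset.prod_congr rfl fun i _ => shift i,
      Finset.prod_mul_distrib, Finset.prod_const, Finset.card_range, ih, pow_zero,
      ← X_sub_one_mul_qInt, qFact, hchoose]
    ring

theorem prod_range_prod_range_X_pow_sub_X_pow (n : ℕ) :
    ∏ j ∈ Finset.range n, ∏ i ∈ Finset.range j, ((X : Polynomial ℤ) ^ j - X ^ i) =
      X ^ (n.choose 3) * (X - 1) ^ (n.choose 2) * ∏ j ∈ Finset.range n, qFact j := by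
  induction n with
  | zero => simp
  | succ n ih =>
    rw [Finset.prod_range_succ, ih, prod_range_X_pow_sub_X_pow, Finset.prod_range_succ,
      Nat.choose_succ_succ' n 2, Nat.choose_succ_succ' n 1, Nat.choose_one_right]
    ring

theorem det_vandermonde_eq_prod_range {R : Type*} [CommRing R] (n : ℕ) (f : ℕ → R) :
    Matrix.det (Matrix.vandermonde fun i : Fin n => f i) =
      ∏ j ∈ Finset.range n, ∏ i ∈ Finset.range j, (f j - f i) := by
  rw [Matrix.det_vandermonde, ← Fin.prod_univ_eq_prod_range
    (fun j => ∏ i ∈ Finset.range j, (f j - f i)),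
    Finset.prod_comm' (t' := Finset.univ) (s' := fun j => Finset.Iio j) (by simp)]
  refine Finset.prod_congr rfl fun j _ => ?_
  rw [← Nat.Iio_eq_range, ← Fin.map_valEmbedding_Iio, Finset.prod_map]
  rfl

/-- The Vandermonde-type determinant
`det(q^{ij})_{i,j=0}^{n-1} = q^{C(n,3)} (q-1)^{C(n,2)} ∏_{j=0}^{n-1} [j]_q!`. -/
theorem stmt0 (n : ℕ) :
    Matrix.det (Matrix.of fun i j : Fin n => (X : Polynomial ℤ) ^ ((i : ℕ) * (j : ℕ))) =
      X ^ (n.choose 3) * (X - 1) ^ (n.choose 2) * ∏ j ∈ Finset.range n, qFact j := by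
  rw [← prod_range_prod_range_X_pow_sub_X_pow,
    ← det_vandermonde_eq_prod_range n fun i => (X : Polynomial ℤ) ^ i]
  congr 1
  ext1 i j
  simp [Matrix.vandermonde_apply, pow_mul]
end
end

section
/- For every m ∈ ℤ and n ≥ 0, the integer E(m,n) = 3C(n,3) + 2m·C(n,2) + n·C(m,2) is nonnegative, and the Hankel determinant d_{m,n}(q) = det(q^{C(m+i+j,2)})_{i,j=0}^{n−1} equals q^{E(m,n)} (q−1)^{C(n,2)} ∏_{j=0}^{n−1} [j]_q!. -/
open Polynomial Finset

noncomputable section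

theorem two_mul_int_choose_two (m : ℤ) : 2 * (m * (m - 1) / 2) = m * (m - 1) :=
  Int.mul_ediv_cancel' (Int.even_mul_pred_self m).two_dvd

theorem natCast_C2 (m : ℤ) : (C2 m : ℤ) = m * (m - 1) / 2 := by
  refine Int.toNat_of_nonneg (Int.ediv_nonneg ?_ (by norm_num))
  rcases le_or_gt m 0 with h | h <;> nlinarith

theorem two_mul_choose_two (n : ℕ) : 2 * (n.choose 2 : ℤ) = n * (n - 1) := by
  induction n with
  | zero => simp
  | succ n ih =>
    rw [Nat.choose_succ_succ' n 1, Nat.choose_one_right]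
    push_cast
    linarith

theorem six_mul_choose_three (n : ℕ) : 6 * (n.choose 3 : ℤ) = n * (n - 1) * (n - 2) := by
  induction n with
  | zero => simp
  | succ n ih =>
    rw [Nat.choose_succ_succ' n 2]
    push_cast
    linarith [two_mul_choose_two n]

/-- The exponent `E(m,n)` equals `n C(m+n-1,2)`. -/
theorem hankel_exponent_eq (m : ℤ) (n : ℕ) :
    3 * (n.choose 3 : ℤ) + 2 * m * (n.choose 2 : ℤ) + (n : ℤ) * (m * (m - 1) / 2) =
      n * C2 (m + n - 1) := by
  have h : 2 * (C2 (m + n - 1) : ℤ) = (m + n - 1) * (m + n - 1 - 1) := by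
    rw [natCast_C2, two_mul_int_choose_two]
  refine mul_left_cancel₀ (two_ne_zero (α := ℤ)) ?_
  linear_combination six_mul_choose_three n + 2 * m * two_mul_choose_two n +
    n * two_mul_int_choose_two m - n * h

theorem natCast_C2_add_add (m : ℤ) (i j : ℕ) :
    (C2 (m + i + j) : ℤ) =
      (m * (m - 1) / 2 + i.choose 2 + m * i) + i * j + (0 + j.choose 2 + m * j) := by
  have h : 2 * (C2 (m + i + j) : ℤ) = (m + i + j) * (m + i + j - 1) := by
    rw [natCast_C2, two_mul_int_choose_two]
  linarith [two_mul_int_choose_two m, two_mul_choose_two i, two_mul_choose_two j]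

theorem prod_X_pow_succ_sub_one (n : ℕ) :
    ∏ j ∈ range n, ((X : ℤ[X]) ^ (j + 1) - 1) = (X - 1) ^ n * qFact n := by
  induction n with
  | zero => simp [qFact]
  | succ n ih =>
    rw [prod_range_succ, ih, qFact, qInt, ← geom_sum_mul]
    ring

theorem det_vandermonde_X_pow (k n : ℕ) :
    (Matrix.vandermonde fun i : Fin n => (X : ℤ[X]) ^ (k + (i : ℕ))).det =
      X ^ (k * n.choose 2 + n.choose 3) * (X - 1) ^ n.choose 2 * ∏ j ∈ range n, qFact j := by
  induction n generalizing k with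
  | zero => simp
  | succ n ih =>
    have hrow : ∏ j : Fin n, ((X : ℤ[X]) ^ (k + (j.succ : ℕ)) - X ^ (k + ((0 : Fin (n + 1)) : ℕ))) =
        X ^ (k * n) * ((X - 1) ^ n * qFact n) := by
      rw [← prod_X_pow_succ_sub_one, pow_mul, ← Fin.prod_univ_eq_prod_range
        (fun j => (X : ℤ[X]) ^ (j + 1) - 1), ← Fin.prod_const n (X ^ k), ← prod_mul_distrib]
      refine prod_congr rfl fun j _ => ?_
      simp only [Fin.val_succ, Fin.val_zero]
      ring
    have hrest := ih (k + 1)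
    rw [Matrix.det_vandermonde] at hrest ⊢
    rw [Fin.prod_univ_succ, Fin.prod_Ioi_zero, hrow]
    simp only [Fin.prod_Ioi_succ, Fin.val_succ]
    simp only [add_assoc, add_comm 1] at hrest ⊢
    rw [hrest, prod_range_succ, Nat.choose_succ_succ' n 1, Nat.choose_succ_succ' n 2,
      Nat.choose_one_right]
    ring

theorem prod_zpow_add_choose_two {K : Type*} [Field K] {x : K} (hx : x ≠ 0) (c m : ℤ) (n : ℕ) :
    ∏ i : Fin n, x ^ (c + ((i : ℕ).choose 2 : ℤ) + m * ((i : ℕ) : ℤ)) =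
      x ^ (n * c + n.choose 3 + m * n.choose 2) := by
  induction n with
  | zero => simp
  | succ n ih =>
    rw [Fin.prod_univ_castSucc]
    simp only [Fin.val_castSucc, Fin.val_last]
    rw [ih, ← zpow_add₀ hx, Nat.choose_succ_succ' n 1, Nat.choose_succ_succ' n 2,
      Nat.choose_one_right]
    congr 1
    push_cast
    ring

/-- Splitting off row and column factors turns the Hankel determinant into a Vandermonde one. -/
theorem det_zpow_C2_eq {K : Type*} [Field K] {x : K} (hx : x ≠ 0) (m : ℤ) (n : ℕ) :
    (Matrix.of fun i j : Fin n => x ^ C2 (m + (i : ℤ) + (j : ℤ))).det =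
      x ^ (2 * (n.choose 3 : ℤ) + 2 * m * n.choose 2 + n * (m * (m - 1) / 2)) *
        (Matrix.vandermonde fun i : Fin n => x ^ (i : ℕ)).det := by
  have hfactor : (Matrix.of fun i j : Fin n => x ^ C2 (m + (i : ℤ) + (j : ℤ))) =
      Matrix.of fun i j : Fin n => x ^ (m * (m - 1) / 2 + ((i : ℕ).choose 2 : ℤ) + m * (i : ℕ)) *
        Matrix.of (fun i j : Fin n => x ^ (0 + ((j : ℕ).choose 2 : ℤ) + m * (j : ℕ)) *
          Matrix.vandermonde (fun i : Fin n => x ^ (i : ℕ)) i j) i j := by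
    ext i j
    simp only [Matrix.of_apply, Matrix.vandermonde_apply]
    rw [← zpow_natCast, natCast_C2_add_add, zpow_add₀ hx, zpow_add₀ hx (_ + _ + _), ← pow_mul,
      ← Nat.cast_mul, zpow_natCast]
    ring
  rw [hfactor, Matrix.det_mul_column, Matrix.det_mul_row, prod_zpow_add_choose_two hx,
    prod_zpow_add_choose_two hx, ← mul_assoc, ← zpow_add₀ hx]
  congr 2
  ring

/-- `E(m,n) = 3C(n,3) + 2m C(n,2) + n C(m,2)` is nonnegative and
`d_{m,n}(q) = q^{E(m,n)} (q-1)^{C(n,2)} ∏_{j=0}^{n-1} [j]_q!`. -/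
theorem stmt1 (m : ℤ) (n : ℕ) :
    0 ≤ 3 * (n.choose 3 : ℤ) + 2 * m * (n.choose 2 : ℤ) + (n : ℤ) * (m * (m - 1) / 2) ∧
    dd m n =
      X ^ (3 * (n.choose 3 : ℤ) + 2 * m * (n.choose 2 : ℤ) + (n : ℤ) * (m * (m - 1) / 2)).toNat *
        (X - 1) ^ (n.choose 2) * ∏ j ∈ Finset.range n, qFact j := by
  have hE : 0 ≤ 3 * (n.choose 3 : ℤ) + 2 * m * (n.choose 2 : ℤ) + (n : ℤ) * (m * (m - 1) / 2) := by
    rw [hankel_exponent_eq]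
    positivity
  refine ⟨hE, ?_⟩
  set φ := algebraMap ℤ[X] (FractionRing ℤ[X])
  have hφ : Function.Injective φ := IsFractionRing.injective _ _
  have hx : φ X ≠ 0 := (map_ne_zero_iff φ hφ).2 X_ne_zero
  have hdd : φ (dd m n) =
      (Matrix.of fun i j : Fin n => φ X ^ C2 (m + (i : ℤ) + (j : ℤ))).det := by
    rw [dd, RingHom.map_det]
    congr 1
    ext i j
    simp
  have hvand : (Matrix.vandermonde fun i : Fin n => φ X ^ (i : ℕ)).det =
      φ (X ^ n.choose 3 * (X - 1) ^ n.choose 2 * ∏ j ∈ range n, qFact j) := by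
    have h := det_vandermonde_X_pow 0 n
    simp only [zero_add, zero_mul] at h
    rw [← h, RingHom.map_det]
    congr 1
    ext i j
    simp [Matrix.vandermonde_apply]
  apply hφ
  rw [hdd, det_zpow_C2_eq hx, hvand]
  simp only [map_mul, map_pow, ← mul_assoc]
  congr 2
  rw [← zpow_natCast, ← zpow_natCast, ← zpow_add₀ hx, Int.toNat_of_nonneg hE]
  congr 1
  ring
end
end

section
/- For every integer n ≥ 0, r_{2,n}(q) = ∑_{j=0}^{n} r_{1,j}(q)^2 · (q−1)^{n−j} · (∏_{i=j+2}^{n+1} [i]_q) · q^{((n+1)(n+4) − (j+1)(j+4))/2}, where the exponent ((n+1)(n+4) − (j+1)(j+4))/2 is a nonnegative integer for 0 ≤ j ≤ n. -/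
open Polynomial Finset

noncomputable section

theorem r1_zero : r1 0 = 1 := by
  simp [r1, qFact, qInt]

theorem exponent_succ {n j : ℕ} (h : j ≤ n) :
    ((n + 2) * (n + 5) - (j + 1) * (j + 4)) / 2 =
      ((n + 1) * (n + 4) - (j + 1) * (j + 4)) / 2 + (n + 3) := by
  have hle : (j + 1) * (j + 4) ≤ (n + 1) * (n + 4) := by gcongr
  have hstep : (n + 2) * (n + 5) = (n + 1) * (n + 4) + 2 * (n + 3) := by ring
  omega

/-- `r_{2,n}(q) = ∑_{j=0}^n r_{1,j}(q)^2 (q-1)^{n-j} (∏_{i=j+2}^{n+1} [i]_q)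
q^{((n+1)(n+4)-(j+1)(j+4))/2}`. -/
theorem stmt7 (n : ℕ) :
    r2 n =
      ∑ j ∈ Finset.range (n + 1),
        r1 j ^ 2 * (X - 1) ^ (n - j) * (∏ i ∈ Finset.Icc (j + 2) (n + 1), qInt i) *
          X ^ (((n + 1) * (n + 4) - (j + 1) * (j + 4)) / 2) := by
  induction n with
  | zero => simp [r2, r1_zero]
  | succ n ih =>
    rw [Finset.sum_range_succ, r2, ih, Finset.mul_sum, add_comm]
    refine congrArg₂ (· + ·) (Finset.sum_congr rfl fun j hj => ?_) ?_
    · have hjn : j ≤ n := Nat.lt_succ_iff.mp (Finset.mem_range.mp hj)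
      have hexp := exponent_succ hjn
      have hprod := Finset.prod_Icc_succ_top (by omega : j + 2 ≤ n + 1 + 1) qInt
      rw [hprod, Nat.succ_sub hjn, ← X_sub_one_mul_qInt, hexp, pow_add X _ (n + 3),
        pow_succ (X - 1)]
      ring
    · simp
end
end

section
/- For every integer n ≥ 0, the polynomial r_{2,n}(q) ∈ ℤ[q] has degree n(n+4). -/
open Polynomial Finset

noncomputable section

theorem X_sub_one_pow_mul_qFact_succ (n : ℕ) :
    (X - 1) ^ (n + 1) * qFact (n + 1) = (X - 1) ^ n * qFact n * (X ^ (n + 1) - 1) := by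
  rw [← geom_sum_mul (X : ℤ[X]) (n + 1), qFact, qInt]
  ring

theorem monic_X_sub_one_pow_mul_qFact (n : ℕ) : ((X - 1) ^ n * qFact n).Monic := by
  induction n with
  | zero => simp [qFact]
  | succ n ih =>
    rw [X_sub_one_pow_mul_qFact_succ]
    exact ih.mul (monic_X_pow_sub_C 1 n.succ_ne_zero)

theorem natDegree_X_pow_sub_one (n : ℕ) : (X ^ n - 1 : ℤ[X]).natDegree = n :=
  natDegree_X_pow_sub_C (r := 1)

theorem natDegree_X_sub_one_pow_mul_qFact (n : ℕ) :
    ((X - 1) ^ n * qFact n).natDegree = (n + 1).choose 2 := by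
  induction n with
  | zero => simp [qFact]
  | succ n ih =>
    have hX : (X ^ (n + 1) - 1 : ℤ[X]).Monic := monic_X_pow_sub_C 1 n.succ_ne_zero
    rw [X_sub_one_pow_mul_qFact_succ, (monic_X_sub_one_pow_mul_qFact n).natDegree_mul hX, ih, natDegree_X_pow_sub_one,
      Nat.choose_succ_succ' (n + 1) 1, Nat.choose_one_right, add_comm]

/-- The leading terms of the two monic summands of `r_{1,n}` cancel. -/
theorem natDegree_r1_lt (n : ℕ) : (r1 n).natDegree < (n + 2).choose 2 := by
  have hm := monic_X_sub_one_pow_mul_qFact (n + 1)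
  have hdeg := natDegree_X_sub_one_pow_mul_qFact (n + 1)
  have hlt : (r1 n).degree < (X ^ (n + 2).choose 2 : ℤ[X]).degree := by
    refine degree_sub_lt_left ?_ (monic_X_pow _).ne_zero ?_
    · rw [degree_X_pow, degree_eq_natDegree hm.ne_zero, hdeg]
    · rw [(monic_X_pow _).leadingCoeff, hm.leadingCoeff]
  rw [degree_X_pow] at hlt
  rcases eq_or_ne (r1 n) 0 with h | h
  · simpa [h] using Nat.choose_pos (show 2 ≤ n + 2 by lia)
  · exact (natDegree_lt_iff_degree_lt h).2 hlt

theorem natDegree_r1_sq_lt (n : ℕ) : (r1 (n + 1) ^ 2).natDegree < (n + 1) * (n + 5) := by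
  have hlt := natDegree_r1_lt (n + 1)
  have hchoose : (n + 3).choose 2 * 2 = (n + 3) * (n + 2) := by
    rw [Nat.choose_two_right]
    exact Nat.div_mul_cancel (Nat.even_mul_pred_self (n + 3)).two_dvd
  have hpow := natDegree_pow_le (p := r1 (n + 1)) (n := 2)
  nlinarith

theorem monic_r2_and_natDegree_r2 (n : ℕ) :
    (r2 n).Monic ∧ (r2 n).natDegree = n * (n + 4) := by
  induction n with
  | zero => simp [r2]
  | succ n ih =>
    obtain ⟨hm, hd⟩ := ih
    have hX : (X ^ (n + 2) - 1 : ℤ[X]).Monic := monic_X_pow_sub_C 1 (n + 1).succ_ne_zero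
    have hXX := hX.mul (monic_X_pow (R := ℤ) (n + 3))
    have hmonic := hXX.mul hm
    have hdeg : ((X ^ (n + 2) - 1) * X ^ (n + 3) * r2 n).natDegree = (n + 1) * (n + 5) := by
      rw [hXX.natDegree_mul hm, hX.natDegree_mul (monic_X_pow _), natDegree_X_pow_sub_one,
        natDegree_X_pow, hd]
      ring
    have hlt := (natDegree_r1_sq_lt n).trans_eq hdeg.symm
    rw [r2]
    exact ⟨hmonic.add_of_right (degree_lt_degree hlt),
      (natDegree_add_eq_right_of_natDegree_lt hlt).trans hdeg⟩

/-- `r_{2,n}(q)` has degree `n(n+4)`. -/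
theorem stmt8 (n : ℕ) : (r2 n).natDegree = n * (n + 4) := by
  exact (monic_r2_and_natDegree_r2 n).2
end
end

section
/- (Theorem 3) For every integer n ≥ 0, v_{2,n}(q) = (−1)^{C(n+1,2)} u(n,q); equivalently, for every m ≥ 0 the determinant D_{−m,m+2}(q) equals (−1)^{C(m+3,2)} u(m+2,q), so that the polynomial r_{m,1}(q) determined by D_{−m,m+2}(q) = (−1)^{C(m+1,2)} (q−1) r_{m,1}(q) equals u(m+2,q)/(1−q). -/
open Polynomial Finset

noncomputable section

theorem sign_finRevPerm (n : ℕ) :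
    Equiv.Perm.sign (Fin.revPerm : Equiv.Perm (Fin n)) = (-1) ^ n.choose 2 := by
  induction n with
  | zero => simp [Subsingleton.elim (Fin.revPerm : Equiv.Perm (Fin 0)) 1]
  | succ n ih =>
    have h : finRotate (n + 1) * Fin.revPerm = Equiv.Perm.decomposeFin.symm (0, Fin.revPerm) := by
      ext i
      refine Fin.cases ?_ (fun i => ?_) i
      · simp
      · simp [Fin.rev_succ]
    have hs := congrArg Equiv.Perm.sign h
    rw [Equiv.Perm.sign_mul, sign_finRotate, Equiv.Perm.decomposeFin.symm_sign, ih] at hs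
    simp only [Nat.succ_sub_one, if_true, one_mul] at hs
    rw [Nat.choose_succ_succ' n 1, Nat.choose_one_right, pow_add, ← hs, ← mul_assoc, ← pow_add,
      ← two_mul, pow_mul, neg_one_sq, one_pow, one_mul]

/-- If `∑ u n x ^ n` is the inverse of `∑ c n x ^ n` and `c 0 = 1`, then `u n` is, up to sign, the
determinant of the Hessenberg Toeplitz matrix with entries `c (i + 1 - j)`. -/
theorem det_toeplitz_hessenberg {R : Type*} [CommRing R] (c : ℤ → R) (hneg : ∀ k < 0, c k = 0)
    (hc0 : c 0 = 1) (u : ℕ → R) (hu0 : u 0 = 1)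
    (hu : ∀ n : ℕ, 1 ≤ n → ∑ j ∈ range (n + 1), c j * u (n - j) = 0) (n : ℕ) :
    Matrix.det (Matrix.of fun i j : Fin n => c ((i : ℤ) + 1 - j)) = (-1) ^ n * u n := by
  let L : Matrix (Fin (n + 1)) (Fin (n + 1)) R := Matrix.of fun i j => c ((i : ℤ) - j)
  have hdet : L.det = 1 := by
    rw [Matrix.det_of_isLowerTriangular L]
    · simp [L, hc0]
    · intro i j hij
      have hlt : (i : ℕ) < j := hij
      exact hneg _ (by omega)
  have hconv : L.mulVec (fun k => u k) = Pi.single 0 1 := by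
    ext i
    have hsum : L.mulVec (fun k => u k) i = ∑ j ∈ range (i + 1), c j * u (i - j) := by
      simp only [Matrix.mulVec, dotProduct, L, Matrix.of_apply]
      rw [Fin.sum_univ_eq_sum_range (fun k => c ((i : ℤ) - k) * u k) (n + 1),
        ← sum_range_reflect (fun j => c j * u (i - j)) (i + 1)]
      symm
      refine (sum_congr rfl fun j hj => ?_).trans
        (sum_subset (range_mono (show (i : ℕ) + 1 ≤ n + 1 by omega)) fun j _ hj => ?_)
      · rw [mem_range] at hj
        rw [show (i : ℕ) + 1 - 1 - j = i - j by omega, Nat.cast_sub (by omega),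
          show (i : ℕ) - (i - j) = j by omega]
      · rw [mem_range] at hj
        rw [hneg _ (by omega), zero_mul]
    rw [hsum]
    rcases Fin.eq_zero_or_eq_succ i with rfl | ⟨i, rfl⟩
    · simp [hc0, hu0]
    · rw [hu _ (by simp)]
      simp
  have hadj : L.adjugate (Fin.last n) 0 = u n := by
    have h := congrArg (fun v => L.adjugate.mulVec v (Fin.last n)) hconv
    simpa [Matrix.mulVec_mulVec, Matrix.adjugate_mul, hdet] using h.symm
  rw [Matrix.adjugate_fin_succ_eq_det_submatrix] at hadj
  have hsub : L.submatrix (Fin.succAbove 0) (Fin.succAbove (Fin.last n)) =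
      Matrix.of fun i j : Fin n => c ((i : ℤ) + 1 - j) := by
    ext i j
    simp [L]
  rw [hsub] at hadj
  rw [← hadj, ← mul_assoc, ← pow_add]
  simp [← two_mul]

theorem C2_natCast (j : ℕ) : C2 j = j.choose 2 := by
  rw [C2, Nat.choose_two_right]
  cases j with
  | zero => simp
  | succ j =>
    push_cast
    rw [add_sub_cancel_right]
    exact_mod_cast Int.toNat_natCast _

theorem a_natCast (j : ℕ) : a j = X ^ j.choose 2 := by
  rw [a, if_neg (by omega), C2_natCast]

theorem vv_two (u : ℕ → Polynomial ℤ) (hu0 : u 0 = 1)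
    (hu : ∀ n : ℕ, 1 ≤ n → ∑ j ∈ Finset.range (n + 1), X ^ (j.choose 2) * u (n - j) = 0) (n : ℕ) :
    vv 2 n = (-1) ^ ((n + 1).choose 2) * u n := by
  have ha0 : a 0 = 1 := by simpa using a_natCast 0
  have hT := det_toeplitz_hessenberg a (fun k hk => if_pos hk) ha0 u hu0
    (by simpa only [a_natCast] using hu) n
  have hM : (Matrix.of fun i j : Fin n => a (2 - (n : ℤ) + (i : ℤ) + (j : ℤ))) =
      ((Matrix.of fun i j : Fin n => a ((i : ℤ) + 1 - j)).transpose).submatrix Fin.revPerm id := by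
    ext1 i j
    simp only [Matrix.of_apply, Matrix.submatrix_apply, Matrix.transpose_apply, id,
      Fin.revPerm_apply, Fin.val_rev]
    congr 1
    omega
  rw [vv, hM, Matrix.det_permute, Matrix.det_transpose, hT, sign_finRevPerm, ← mul_assoc,
    Nat.choose_succ_succ' n 1, Nat.choose_one_right, add_comm n, pow_add]
  simp

/-- Theorem 3: `v_{2,n}(q) = (-1)^{C(n+1,2)} u(n,q)`; equivalently
`D_{-m,m+2}(q) = (-1)^{C(m+3,2)} u(m+2,q)`, so the polynomial `r_{m,1}(q)` determined by
`D_{-m,m+2}(q) = (-1)^{C(m+1,2)} (q-1) r_{m,1}(q)` equals `u(m+2,q)/(1-q)`. -/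
theorem stmt12 (u : ℕ → Polynomial ℤ) (hu0 : u 0 = 1)
    (hu : ∀ n : ℕ, 1 ≤ n → ∑ j ∈ Finset.range (n + 1), X ^ (j.choose 2) * u (n - j) = 0) :
    (∀ n : ℕ, vv 2 n = (-1) ^ ((n + 1).choose 2) * u n) ∧
    (∀ m : ℕ, DD (-(m : ℤ)) (m + 2) = (-1) ^ ((m + 3).choose 2) * u (m + 2)) ∧
    (∀ m : ℕ, ∀ r : Polynomial ℤ,
      DD (-(m : ℤ)) (m + 2) = (-1) ^ ((m + 1).choose 2) * (X - 1) * r →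
        (1 - X) * r = u (m + 2)) := by
  have hD (m : ℕ) : DD (-(m : ℤ)) (m + 2) = (-1) ^ ((m + 3).choose 2) * u (m + 2) := by
    rw [← vv_two u hu0 hu (m + 2), DD, vv]
    push_cast
    simp only [sub_add_cancel_right]
  refine ⟨vv_two u hu0 hu, hD, fun m r hr => ?_⟩
  have hsign : (m + 3).choose 2 = (m + 1).choose 2 + (2 * (m + 1) + 1) := by
    rw [Nat.choose_succ_succ' (m + 2) 1, Nat.choose_succ_succ' (m + 1) 1]
    simp only [Nat.choose_one_right, Nat.reduceAdd]
    omega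
  rw [hD, hsign, pow_add, mul_assoc, mul_assoc] at hr
  have h := ((isUnit_one.neg).pow _).mul_left_cancel hr
  rw [pow_succ, pow_mul, neg_one_sq, one_pow] at h
  linear_combination h
end
end

section
/- For every integer n ≥ 0, the polynomial u(n,q) ∈ ℤ[q] has degree C(n,2) = n(n−1)/2. -/
open Polynomial Finset

noncomputable section

theorem Nat.add_choose_two_eq (j k : ℕ) :
    (j + k).choose 2 = j.choose 2 + k.choose 2 + j * k := by
  induction k with
  | zero => simp
  | succ k ih =>
    rw [← Nat.add_assoc, Nat.choose_succ_succ' (j + k) 1, Nat.choose_succ_succ' k 1, ih]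
    simp only [Nat.choose_one_right]
    ring

/-- `u(n,q)` has degree `C(n,2) = n(n-1)/2`. -/
theorem stmt13 (u : ℕ → Polynomial ℤ) (hu0 : u 0 = 1)
    (hu : ∀ n : ℕ, 1 ≤ n → ∑ j ∈ Finset.range (n + 1), X ^ (j.choose 2) * u (n - j) = 0)
    (n : ℕ) : (u n).natDegree = n.choose 2 := by
  induction n using Nat.strong_induction_on with
  | _ n ih =>
    rcases n with _ | m
    · simp [hu0]
    have h := hu (m + 1) (by omega)
    rw [Finset.sum_range_succ', Finset.sum_range_succ] at h
    simp only [Nat.choose_zero_succ, pow_zero, one_mul, Nat.sub_zero, Nat.sub_self, hu0,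
      mul_one] at h
    set S : Polynomial ℤ :=
      ∑ j ∈ Finset.range m, X ^ ((j + 1).choose 2) * u (m + 1 - (j + 1))
    have hSdeg : S.degree < ((X : Polynomial ℤ) ^ ((m + 1).choose 2)).degree := by
      rw [degree_X_pow, ← mem_degreeLT]
      refine Submodule.sum_mem _ fun j hj => mem_degreeLT.2 ?_
      obtain ⟨k, rfl⟩ := Nat.exists_eq_add_of_lt (Finset.mem_range.1 hj)
      have hsub : j + k + 1 + 1 - (j + 1) = k + 1 := by omega
      have hadd : j + k + 1 + 1 = (j + 1) + (k + 1) := by omega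
      rw [hsub, hadd, Nat.add_choose_two_eq (j + 1) (k + 1)]
      refine degree_le_natDegree.trans_lt (Nat.cast_lt.2 ?_)
      refine natDegree_mul_le.trans_lt ?_
      rw [natDegree_X_pow, ih (k + 1) (by omega)]
      exact Nat.lt_add_of_pos_right (by positivity)
    rw [eq_neg_of_add_eq_zero_right h, natDegree_neg,
      natDegree_add_eq_right_of_degree_lt hSdeg, natDegree_X_pow]
end
end

section
/- (Andrews–Wimp lemma) Let R be a commutative ring and let s, t : ℤ → R satisfy s_n = t_n = 0 for n < 0, s_0 = 1, and ∑_{k=0}^{n} s_k t_{n−k} = 1 if n = 0 and 0 if n > 0 (i.e. the power series ∑ s_n x^n and ∑ t_n x^n are mutually inverse). Then for all integers M ≥ 0 and N ≥ 0, det(s_{i+j−M})_{i,j=0}^{N+M} = (−1)^{N + C(M+1,2)} · det(t_{i+j+M+2})_{i,j=0}^{N−1}, where the left-hand determinant is (N+M+1)×(N+M+1), the right-hand determinant is N×N, and an empty determinant equals 1. -/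
open Polynomial Finset

noncomputable section

/-- The determinant of the antidiagonal permutation matrix. -/
lemma det_antidiagonal {R : Type*} [CommRing R] (m : ℕ) :
    Matrix.det (Matrix.of fun i j : Fin m => if (i : ℕ) + (j : ℕ) + 1 = m then (1 : R) else 0) =
      (-1) ^ m.choose 2 := by
  induction m with
  | zero => simp
  | succ m ih =>
    rw [Matrix.det_succ_row_zero, Finset.sum_eq_single (Fin.last m)]
    · have hsub : (Matrix.of fun i j : Fin (m + 1) =>
          if (i : ℕ) + (j : ℕ) + 1 = m + 1 then (1 : R) else 0).submatrix
            Fin.succ (Fin.last m).succAbove =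
          Matrix.of fun i j : Fin m => if (i : ℕ) + (j : ℕ) + 1 = m then (1 : R) else 0 := by
        ext i j
        simp only [Matrix.submatrix_apply, Matrix.of_apply, Fin.val_succ, Fin.succAbove_last,
          Fin.val_castSucc]
        congr 1
        exact propext ⟨fun h => by omega, fun h => by omega⟩
      rw [hsub, ih, Nat.choose_succ_succ' m 1]
      simp [pow_add]
    · intro j _ hj
      have : (j : ℕ) ≠ m := fun h => hj (Fin.ext h)
      simp [this]
    · simp

/-- A sum over a window containing the support of the convolution of two mutually inverse
sequences. -/
lemma sum_range_mul_eq_ite {R : Type*} [CommRing R] {s t : ℤ → R}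
    (hs : ∀ n : ℤ, n < 0 → s n = 0) (ht : ∀ n : ℤ, n < 0 → t n = 0)
    (hst : ∀ n : ℕ, ∑ k ∈ Finset.range (n + 1), s (k : ℤ) * t ((n : ℤ) - (k : ℤ)) =
      if n = 0 then 1 else 0)
    {a b : ℤ} {K : ℕ} (ha : a ≤ 0) (hb : b < K) :
    ∑ m ∈ Finset.range K, s (a + m) * t (b - m) = if a + b = 0 then 1 else 0 := by
  rcases lt_or_ge (a + b) 0 with hab | hab
  · rw [if_neg hab.ne]
    refine Finset.sum_eq_zero fun m _ => ?_
    rcases lt_or_ge (a + m) 0 with h | h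
    · rw [hs _ h, zero_mul]
    · rw [ht (b - m) (by omega), mul_zero]
  · obtain ⟨n, hn⟩ := Int.eq_ofNat_of_zero_le hab
    obtain ⟨A, hA⟩ := Int.eq_ofNat_of_zero_le (neg_nonneg.mpr ha)
    obtain ⟨r, rfl⟩ : ∃ r, K = A + (n + 1) + r := ⟨K - (A + (n + 1)), by omega⟩
    rw [Finset.sum_range_add, Finset.sum_range_add]
    have h₁ : ∑ m ∈ Finset.range A, s (a + m) * t (b - m) = 0 :=
      Finset.sum_eq_zero fun m hm => by
        rw [Finset.mem_range] at hm
        rw [hs (a + m) (by omega), zero_mul]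
    have h₂ : ∑ m ∈ Finset.range r, s (a + (A + (n + 1) + m : ℕ)) *
        t (b - (A + (n + 1) + m : ℕ)) = 0 :=
      Finset.sum_eq_zero fun m _ => by
        rw [ht (b - (A + (n + 1) + m : ℕ)) (by omega), mul_zero]
    rw [h₁, h₂, zero_add, add_zero, hn]
    simp only [Int.natCast_eq_zero]
    rw [← hst n]
    refine Finset.sum_congr rfl fun m _ => ?_
    congr 2 <;> push_cast <;> omega

/-- Multiplying the shifted Hankel matrix of `s` by the Toeplitz matrix of `t`. -/
lemma sum_hankel_mul_toeplitz {R : Type*} [CommRing R] {s t : ℤ → R}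
    (hs : ∀ n : ℤ, n < 0 → s n = 0) (ht : ∀ n : ℤ, n < 0 → t n = 0)
    (hst : ∀ n : ℕ, ∑ k ∈ Finset.range (n + 1), s (k : ℤ) * t ((n : ℤ) - (k : ℤ)) =
      if n = 0 then 1 else 0)
    {M N i k : ℕ} (hi : i < M + 1 + N) (hk : k < M + 1 + N) :
    ∑ j ∈ Finset.range (M + 1 + N), s ((i : ℤ) + j - M) * t ((k : ℤ) - j) =
      (if i + k = M then 1 else 0) -
        ∑ l ∈ Finset.range N, s ((i : ℤ) - 1 - l - M) * t ((k : ℤ) + 1 + l) := by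
  have h := sum_range_mul_eq_ite hs ht hst (a := (i : ℤ) - M - N) (b := (k : ℤ) + N)
    (K := N + (M + 1 + N)) (by omega) (by push_cast; omega)
  rw [Finset.sum_range_add, ← Finset.sum_range_reflect _ N] at h
  have hif : ((i : ℤ) - M - N + (k + N) = 0) = (i + k = M) :=
    propext ⟨fun h => by omega, fun h => by omega⟩
  simp only [hif] at h
  rw [← h, eq_sub_iff_add_eq, add_comm]
  congr 1
  · refine Finset.sum_congr rfl fun l hl => ?_
    rw [Finset.mem_range] at hl
    congr 2 <;> omega
  · refine Finset.sum_congr rfl fun j _ => ?_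
    congr 2 <;> push_cast <;> ring

/-- The determinant of a lower unitriangular Toeplitz matrix. -/
lemma det_lower_toeplitz {R : Type*} [CommRing R] {s : ℤ → R}
    (hs : ∀ n : ℤ, n < 0 → s n = 0) (hs0 : s 0 = 1) (n : ℕ) :
    Matrix.det (Matrix.of fun i j : Fin n => s ((i : ℤ) - (j : ℤ))) = 1 := by
  rw [Matrix.det_of_isLowerTriangular]
  · simp [hs0]
  · intro i j hij
    have : (i : ℕ) < j := hij
    exact hs _ (by omega)

/-- Andrews–Wimp lemma: if `∑ s_n x^n` and `∑ t_n x^n` are mutually inverse power series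
(with `s_n = t_n = 0` for `n < 0` and `s_0 = 1`), then
`det(s_{i+j-M})_{i,j=0}^{N+M} = (-1)^{N+C(M+1,2)} det(t_{i+j+M+2})_{i,j=0}^{N-1}`. -/
theorem stmt14 {R : Type*} [CommRing R] (s t : ℤ → R)
    (hs : ∀ n : ℤ, n < 0 → s n = 0) (ht : ∀ n : ℤ, n < 0 → t n = 0) (hs0 : s 0 = 1)
    (hst : ∀ n : ℕ, ∑ k ∈ Finset.range (n + 1), s (k : ℤ) * t ((n : ℤ) - (k : ℤ)) =
      if n = 0 then 1 else 0)
    (M N : ℕ) :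
    Matrix.det (Matrix.of fun i j : Fin (N + M + 1) => s ((i : ℤ) + (j : ℤ) - (M : ℤ))) =
      (-1) ^ (N + (M + 1).choose 2) *
        Matrix.det (Matrix.of fun i j : Fin N => t ((i : ℤ) + (j : ℤ) + (M : ℤ) + 2)) := by
  have ht0 : t 0 = 1 := by simpa [hs0] using hst 0
  let e : Fin (M + 1) ⊕ Fin N ≃ Fin (N + M + 1) :=
    finSumFinEquiv.trans (finCongr (by omega))
  have he₁ (i : Fin (M + 1)) : (e (Sum.inl i) : ℕ) = i := by simp [e]
  have he₂ (i : Fin N) : (e (Sum.inr i) : ℕ) = M + 1 + i := by simp [e, add_comm]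
  set H := Matrix.of fun i j : Fin (N + M + 1) => s ((i : ℤ) + (j : ℤ) - (M : ℤ)) with hH
  let U := (Matrix.of fun i j : Fin (N + M + 1) => t ((i : ℤ) - (j : ℤ))).transpose
  have hU : U.det = 1 := by
    rw [Matrix.det_transpose, det_lower_toeplitz ht ht0]
  have hHU (i k : Fin (N + M + 1)) : (H * U) i k = (if (i : ℕ) + k = M then 1 else 0) -
      ∑ l ∈ Finset.range N, s ((i : ℤ) - 1 - l - M) * t ((k : ℤ) + 1 + l) := by
    rw [← sum_hankel_mul_toeplitz hs ht hst (by omega) (by omega), Matrix.mul_apply,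
      show M + 1 + N = N + M + 1 by omega, Finset.sum_range]
    rfl
  let L := Matrix.of fun i j : Fin N => s ((i : ℤ) - (j : ℤ))
  let T₁ := Matrix.of fun (i : Fin N) (j : Fin (M + 1)) => t ((i : ℤ) + (j : ℤ) + 1)
  let T₂ := Matrix.of fun i j : Fin N => t ((i : ℤ) + (j : ℤ) + (M : ℤ) + 2)
  let J := Matrix.of fun i j : Fin (M + 1) =>
    if (i : ℕ) + (j : ℕ) + 1 = M + 1 then (1 : R) else 0
  have hblocks : (H * U).submatrix e e = Matrix.fromBlocks J 0 (-(L * T₁)) (-(L * T₂)) := by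
    have htop (i : Fin (M + 1)) (k : ℤ) :
        ∑ l ∈ Finset.range N, s ((i : ℤ) - 1 - l - M) * t (k + 1 + l) = 0 :=
      Finset.sum_eq_zero fun l _ => by rw [hs _ (by omega), zero_mul]
    ext i j
    rcases i with i | i <;> rcases j with j | j <;>
      simp only [Matrix.submatrix_apply, hHU, he₁, he₂, htop, Matrix.fromBlocks_apply₁₁,
        Matrix.fromBlocks_apply₁₂, Matrix.fromBlocks_apply₂₁, Matrix.fromBlocks_apply₂₂,
        Matrix.neg_apply, Matrix.mul_apply, Matrix.zero_apply]
    · simp [J]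
    · rw [if_neg (by omega), sub_zero]
    all_goals
      rw [if_neg (by omega), zero_sub, Finset.sum_range]
      congr 1
      refine Finset.sum_congr rfl fun l _ => ?_
      simp only [L, T₁, T₂, Matrix.of_apply]
      congr 2 <;> push_cast <;> ring
  calc H.det = (H * U).det := by rw [Matrix.det_mul, hU, mul_one]
    _ = ((H * U).submatrix e e).det := (Matrix.det_submatrix_equiv_self e _).symm
    _ = (-1) ^ (N + (M + 1).choose 2) * T₂.det := by
      rw [hblocks, Matrix.det_fromBlocks_zero₁₂, det_antidiagonal, Matrix.det_neg,
        Matrix.det_mul, det_lower_toeplitz hs hs0, Fintype.card_fin, one_mul, pow_add]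
      ring
end
end

section
/- (Condensation identity for the v-determinants) For all integers k ≥ 1 and n ≥ 0 with n + k ≥ 2, v_{k,n+k}(q) · v_{k,n+k−2}(q) − v_{k−1,n+k−1}(q) · v_{k+1,n+k−1}(q) + v_{k,n+k−1}(q)^2 = 0. -/
open Polynomial Finset

noncomputable section

/-- Jacobi's complementary minor identity, up to a factor `M.det`. -/
theorem det_mul_det_toBlocks₂₂_adjugate {m n R : Type*} [Fintype m] [Fintype n] [DecidableEq m]
    [DecidableEq n] [CommRing R] (M : Matrix (m ⊕ n) (m ⊕ n) R) :
    M.det * M.adjugate.toBlocks₂₂.det = M.toBlocks₁₁.det * M.det ^ Fintype.card n := by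
  have hB : M * Matrix.fromBlocks 1 M.adjugate.toBlocks₁₂ 0 M.adjugate.toBlocks₂₂ =
      Matrix.fromBlocks M.toBlocks₁₁ 0 M.toBlocks₂₁ (M.det • 1) := by
    have h := M.mul_adjugate
    generalize M.adjugate = A, M.det = d at h ⊢
    rw [← M.fromBlocks_toBlocks, ← A.fromBlocks_toBlocks,
      Matrix.fromBlocks_multiply, ← Matrix.fromBlocks_one, Matrix.fromBlocks_smul,
      Matrix.fromBlocks_inj] at h
    obtain ⟨-, h₁₂, -, h₂₂⟩ := h
    conv_lhs => rw [← M.fromBlocks_toBlocks]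
    simp [Matrix.fromBlocks_multiply, h₁₂, h₂₂]
  have h := congrArg Matrix.det hB
  rw [Matrix.det_mul, Matrix.det_fromBlocks_zero₂₁, Matrix.det_fromBlocks_zero₁₂] at h
  simpa [Matrix.det_smul] using h

/-- Jacobi's complementary minor identity for a `2 × 2` minor of the adjugate. -/
theorem det_toBlocks₂₂_adjugate {m R : Type*} [Fintype m] [DecidableEq m]
    [CommRing R] (M : Matrix (m ⊕ Fin 2) (m ⊕ Fin 2) R) :
    M.adjugate.toBlocks₂₂.det = M.det * M.toBlocks₁₁.det := by
  let P : Matrix (m ⊕ Fin 2) (m ⊕ Fin 2) R[X] := (X : R[X]) • 1 + M.map C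
  have hP : P.det.Monic := by
    have : P = (-M).charmatrix := by
      ext i j : 1
      by_cases h : i = j <;> simp [P, Matrix.charmatrix, h, Matrix.smul_eq_diagonal_mul]
    rw [this]
    exact Matrix.charpoly_monic _
  have hgen : P.adjugate.toBlocks₂₂.det = P.det * P.toBlocks₁₁.det := by
    apply hP.isRegular.left
    have h := det_mul_det_toBlocks₂₂_adjugate P
    simp only [Fintype.card_fin] at h
    simp only [h]
    ring
  have hM : P.map (evalRingHom 0) = M := by
    ext i j
    by_cases h : i = j <;> simp [P, h]
  have h := congrArg (evalRingHom 0) hgen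
  rw [map_mul, RingHom.map_det, RingHom.map_det, RingHom.map_det] at h
  have hadj : (evalRingHom 0).mapMatrix P.adjugate.toBlocks₂₂ =
      ((evalRingHom 0).mapMatrix P.adjugate).toBlocks₂₂ := rfl
  have htop : (evalRingHom 0).mapMatrix P.toBlocks₁₁ =
      ((evalRingHom 0).mapMatrix P).toBlocks₁₁ := rfl
  rwa [hadj, htop, RingHom.map_adjugate, RingHom.mapMatrix_apply, hM] at h

/-- The Desnanot–Jacobi (Dodgson condensation) identity. -/
theorem det_mul_det_interior {R : Type*} [CommRing R] (m : ℕ)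
    (M : Matrix (Fin (m + 2)) (Fin (m + 2)) R) :
    M.det * (M.submatrix (fun i : Fin m => i.castSucc.succ) fun i : Fin m => i.castSucc.succ).det =
      (M.submatrix Fin.succ Fin.succ).det * (M.submatrix Fin.castSucc Fin.castSucc).det -
      (M.submatrix Fin.succ Fin.castSucc).det * (M.submatrix Fin.castSucc Fin.succ).det := by
  let f : Fin m ⊕ Fin 2 → Fin (m + 2) :=
    Sum.elim (fun i => i.castSucc.succ) ![0, Fin.last (m + 1)]
  have hf : Function.Bijective f := by
    rw [Fintype.bijective_iff_injective_and_card]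
    refine ⟨?_, by simp⟩
    rintro (i | i) (j | j) h
    · simpa [f] using h
    · exfalso
      have := i.2
      fin_cases j <;> simp [f, Fin.ext_iff] at h
      omega
    · exfalso
      have := j.2
      fin_cases i <;> simp [f, Fin.ext_iff] at h
      omega
    · fin_cases i <;> fin_cases j <;> simp [f, Fin.ext_iff] at h ⊢
  let e := Equiv.ofBijective f hf
  have h := det_toBlocks₂₂_adjugate (M.submatrix e e)
  have h0 : e (Sum.inr 0) = 0 := rfl
  have h1 : e (Sum.inr 1) = Fin.last (m + 1) := rfl
  have hint : (M.submatrix e e).toBlocks₁₁ =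
      M.submatrix (fun i : Fin m => i.castSucc.succ) fun i : Fin m => i.castSucc.succ := rfl
  rw [Matrix.det_submatrix_equiv_self, hint, Matrix.adjugate_submatrix_equiv_self,
    Matrix.det_fin_two] at h
  simp only [Matrix.toBlocks₂₂, Matrix.of_apply, Matrix.submatrix_apply, h0, h1,
    Matrix.adjugate_fin_succ_eq_det_submatrix, Fin.succAbove_zero, Fin.succAbove_last,
    Fin.val_zero, Fin.val_last] at h
  have hs : ((-1 : R) ^ (m + 1)) * (-1) ^ (m + 1) = 1 := by
    rw [← mul_pow]; simp
  rw [← h]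
  have hs' : ((-1 : R) ^ (m + 1 + (m + 1))) = 1 := by rw [pow_add, hs]
  simp only [add_zero, zero_add, pow_zero, hs', one_mul]
  linear_combination
    -((M.submatrix Fin.succ Fin.castSucc).det * (M.submatrix Fin.castSucc Fin.succ).det) * hs

/-- Condensation identity for the `v`-determinants:
`v_{k,n+k} v_{k,n+k-2} - v_{k-1,n+k-1} v_{k+1,n+k-1} + v_{k,n+k-1}^2 = 0`
for `k ≥ 1` and `n + k ≥ 2`. -/
theorem stmt16 (k n : ℕ) (hk : 1 ≤ k) (hnk : 2 ≤ n + k) :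
    vv (k : ℤ) (n + k) * vv (k : ℤ) (n + k - 2) -
      vv ((k : ℤ) - 1) (n + k - 1) * vv ((k : ℤ) + 1) (n + k - 1) +
      vv (k : ℤ) (n + k - 1) ^ 2 = 0 := by
  obtain ⟨m, hm⟩ := Nat.exists_eq_add_of_le' hnk
  rw [hm, show m + 2 - 2 = m by omega, show m + 2 - 1 = m + 1 by omega]
  have h := det_mul_det_interior m
    (Matrix.of fun i j : Fin (m + 2) => a (k - ((m + 2 : ℕ) : ℤ) + (i : ℤ) + (j : ℤ)))
  have hmid : vv k m = ((Matrix.of fun i j : Fin (m + 2) =>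
      a (k - ((m + 2 : ℕ) : ℤ) + (i : ℤ) + (j : ℤ))).submatrix
        (fun i : Fin m => i.castSucc.succ) fun i : Fin m => i.castSucc.succ).det := by
    unfold vv
    congr 1; ext1 i j
    simp only [Matrix.of_apply, Matrix.submatrix_apply, Fin.val_succ, Fin.val_castSucc]
    congr 1; push_cast; ring
  have hlow : vv (k - 1) (m + 1) = ((Matrix.of fun i j : Fin (m + 2) =>
      a (k - ((m + 2 : ℕ) : ℤ) + (i : ℤ) + (j : ℤ))).submatrix
        Fin.castSucc Fin.castSucc).det := by
    unfold vv
    congr 1; ext1 i j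
    simp only [Matrix.of_apply, Matrix.submatrix_apply, Fin.val_castSucc]
    congr 1; push_cast; ring
  have hhigh : vv (k + 1) (m + 1) = ((Matrix.of fun i j : Fin (m + 2) =>
      a (k - ((m + 2 : ℕ) : ℤ) + (i : ℤ) + (j : ℤ))).submatrix
        Fin.succ Fin.succ).det := by
    unfold vv
    congr 1; ext1 i j
    simp only [Matrix.of_apply, Matrix.submatrix_apply, Fin.val_succ]
    congr 1; push_cast; ring
  have hleft : vv k (m + 1) = ((Matrix.of fun i j : Fin (m + 2) =>
      a (k - ((m + 2 : ℕ) : ℤ) + (i : ℤ) + (j : ℤ))).submatrix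
        Fin.succ Fin.castSucc).det := by
    unfold vv
    congr 1; ext1 i j
    simp only [Matrix.of_apply, Matrix.submatrix_apply, Fin.val_succ, Fin.val_castSucc]
    congr 1; push_cast; ring
  have hright : vv k (m + 1) = ((Matrix.of fun i j : Fin (m + 2) =>
      a (k - ((m + 2 : ℕ) : ℤ) + (i : ℤ) + (j : ℤ))).submatrix
        Fin.castSucc Fin.succ).det := by
    unfold vv
    congr 1; ext1 i j
    simp only [Matrix.of_apply, Matrix.submatrix_apply, Fin.val_succ, Fin.val_castSucc]
    congr 1; push_cast; ring
  rw [← hmid, ← hlow, ← hhigh, ← hleft, ← hright] at h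
  change vv k (m + 2) * vv k m = _ at h
  linear_combination h
end
end

section
/- In the field ℚ(q) of rational functions, define for integers m ≥ 0 and n ≥ 0 the element r_{m,n}(q) = (−1)^{C(m+1,2)} D_{−m,m+n+1}(q) / (q^{m·C(n,2)} d_{0,n+1}(q)) (this is well defined since d_{0,n+1}(q) ≠ 0). Then for all m ≥ 0 and n ≥ 2, r_{m,n}(q) · (q^n − 1) q^{m+n+1} r_{m+2,n−2}(q) = r_{m,n−1}(q) · r_{m+2,n−1}(q) − r_{m+1,n−1}(q)^2. -/
open Polynomial Finset

noncomputable section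

/-- `a(n,q) = q^{C(n,2)}` for `n ≥ 0` and `a(n,q) = 0` for `n < 0`, in `ℚ(q)`. -/
def aR (m : ℤ) : RatFunc ℚ := if m < 0 then 0 else RatFunc.X ^ C2 m

/-- The Hankel determinant `d_{m,n}(q) = det(q^{C(m+i+j,2)})_{i,j=0}^{n-1}` in `ℚ(q)`. -/
def ddR (m : ℤ) (n : ℕ) : RatFunc ℚ :=
  Matrix.det (Matrix.of fun i j : Fin n => (RatFunc.X : RatFunc ℚ) ^ C2 (m + (i : ℤ) + (j : ℤ)))

/-- The Hankel determinant `D_{m,n}(q) = det(a(m+i+j,q))_{i,j=0}^{n-1}` in `ℚ(q)`. -/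
def DDR (m : ℤ) (n : ℕ) : RatFunc ℚ :=
  Matrix.det (Matrix.of fun i j : Fin n => aR (m + (i : ℤ) + (j : ℤ)))

/-- `r_{m,n}(q) = (-1)^{C(m+1,2)} D_{-m,m+n+1}(q) / (q^{m C(n,2)} d_{0,n+1}(q))` in `ℚ(q)`. -/
def rr (m n : ℕ) : RatFunc ℚ :=
  (-1) ^ ((m + 1).choose 2) * DDR (-(m : ℤ)) (m + n + 1) /
    (RatFunc.X ^ (m * n.choose 2) * ddR 0 (n + 1))

namespace Matrix

variable {R ι κ : Type*} [CommRing R] [Fintype ι] [DecidableEq ι] [Fintype κ] [DecidableEq κ]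

/-- Jacobi's identity for complementary minors of the adjugate, before cancelling `det A`. -/
theorem det_toBlocks₁₁_adjugate_mul_det (A : Matrix (ι ⊕ κ) (ι ⊕ κ) R) :
    (adjugate A).toBlocks₁₁.det * A.det = A.det ^ Fintype.card ι * A.toBlocks₂₂.det := by
  have key : A * fromBlocks (adjugate A).toBlocks₁₁ 0 (adjugate A).toBlocks₂₁ 1 =
      fromBlocks (A.det • 1) A.toBlocks₁₂ 0 A.toBlocks₂₂ := by
    have h := mul_adjugate A
    conv_lhs at h =>
      rw [← fromBlocks_toBlocks (adjugate A)]
      enter [1]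
      rw [← fromBlocks_toBlocks A]
    rw [fromBlocks_multiply, ← fromBlocks_one, fromBlocks_smul, fromBlocks_inj] at h
    conv_lhs =>
      enter [1]
      rw [← fromBlocks_toBlocks A]
    rw [fromBlocks_multiply, h.1, h.2.2.1]
    simp
  have := congrArg det key
  rw [det_mul, det_fromBlocks_zero₁₂, det_fromBlocks_zero₂₁, det_one, mul_one, det_smul, det_one,
    mul_one] at this
  rw [mul_comm, this]

/-- Jacobi's identity for complementary minors of the adjugate. -/
theorem det_toBlocks₁₁_adjugate (A : Matrix (ι ⊕ κ) (ι ⊕ κ) R) [Nonempty ι] :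
    (adjugate A).toBlocks₁₁.det = A.det ^ (Fintype.card ι - 1) * A.toBlocks₂₂.det := by
  let G := mvPolynomialX (ι ⊕ κ) (ι ⊕ κ) ℤ
  have hG : (adjugate G).toBlocks₁₁.det = G.det ^ (Fintype.card ι - 1) * G.toBlocks₂₂.det := by
    apply mul_right_cancel₀ (det_mvPolynomialX_ne_zero (ι ⊕ κ) ℤ)
    have h := det_toBlocks₁₁_adjugate_mul_det G
    rw [← Nat.sub_add_cancel (Fintype.card_pos (α := ι)), pow_succ] at h
    exact h.trans (by ring)
  let f : MvPolynomial ((ι ⊕ κ) × (ι ⊕ κ)) ℤ →ₐ[ℤ] R := MvPolynomial.aeval fun p => A p.1 p.2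
  have hA : f.mapMatrix G = A := mvPolynomialX_mapMatrix_aeval ℤ A
  have h := congrArg f hG
  rw [map_mul, map_pow, AlgHom.map_det, AlgHom.map_det, AlgHom.map_det, hA] at h
  have hadj : f.mapMatrix (adjugate G).toBlocks₁₁ = (adjugate A).toBlocks₁₁ := by
    rw [← hA, ← AlgHom.map_adjugate]
    rfl
  have hblock : f.mapMatrix G.toBlocks₂₂ = A.toBlocks₂₂ := by
    rw [← hA]
    rfl
  rwa [hadj, hblock] at h

/-- The Desnanot–Jacobi identity (Dodgson condensation). -/
theorem det_mul_det_submatrix_inner {n : ℕ} (A : Matrix (Fin (n + 2)) (Fin (n + 2)) R) :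
    A.det * (A.submatrix (fun i : Fin n => i.castSucc.succ) fun j => j.castSucc.succ).det =
      (A.submatrix Fin.succ Fin.succ).det * (A.submatrix Fin.castSucc Fin.castSucc).det -
      (A.submatrix Fin.succ Fin.castSucc).det * (A.submatrix Fin.castSucc Fin.succ).det := by
  let g : Fin 2 ⊕ Fin n → Fin (n + 2) :=
    Sum.elim ![0, Fin.last (n + 1)] fun i => i.castSucc.succ
  have hg : Function.Bijective g := by
    rw [Fintype.bijective_iff_injective_and_card]
    refine ⟨?_, by simp [add_comm]⟩
    rintro (a | a) (b | b) h
    · fin_cases a <;> fin_cases b <;> simp_all [g, Fin.ext_iff]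
    · have := b.2
      fin_cases a <;> simp_all [g, Fin.ext_iff]; omega
    · have := a.2
      fin_cases b <;> simp_all [g, Fin.ext_iff]; omega
    · simp_all [g, Fin.ext_iff]
  let e := Equiv.ofBijective g hg
  have h := det_toBlocks₁₁_adjugate (A.submatrix e e)
  rw [adjugate_submatrix_equiv_self, det_submatrix_equiv_self, det_fin_two] at h
  have h₀ : e (Sum.inl 0) = 0 := rfl
  have h₁ : e (Sum.inl 1) = Fin.last (n + 1) := rfl
  simp only [toBlocks₁₁, of_apply, submatrix_apply, h₀, h₁, adjugate_fin_succ_eq_det_submatrix,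
    Fintype.card_fin, Fin.succAbove_zero, Fin.succAbove_last, Fin.val_zero, Fin.val_last] at h
  have hs : ((-1 : R) ^ (n + 1)) * (-1) ^ (n + 1) = 1 := by rw [← mul_pow]; simp
  have hi : (A.submatrix e e).toBlocks₂₂ =
      A.submatrix (fun i : Fin n => i.castSucc.succ) fun j => j.castSucc.succ := rfl
  rw [hi] at h
  simp only [add_zero, zero_add, pow_zero, one_mul, pow_add _ (n + 1) (n + 1), hs, pow_one,
    Nat.add_one_sub_one] at h
  linear_combination -h - (A.submatrix Fin.succ Fin.castSucc).det *
    (A.submatrix Fin.castSucc Fin.succ).det * hs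

/-- Geometric nodes: the Vandermonde determinant of `1, q, …, q ^ n`. -/
theorem det_vandermonde_pow_succ (q : R) (n : ℕ) :
    (vandermonde fun i : Fin (n + 1) => q ^ (i : ℕ)).det =
      (∏ j ∈ Finset.range n, ((q ^ (j + 1) - 1) * q ^ j)) *
        (vandermonde fun i : Fin n => q ^ (i : ℕ)).det := by
  have h : (vandermonde fun i : Fin n => q ^ ((i : ℕ) + 1)).det =
      (∏ j ∈ Finset.range n, q ^ j) * (vandermonde fun i : Fin n => q ^ (i : ℕ)).det := by
    rw [Finset.prod_range, ← det_mul_row]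
    congr 1
    ext i j
    simp only [vandermonde_apply, of_apply]
    ring
  rw [det_vandermonde, Fin.prod_univ_succ, Fin.prod_Ioi_zero, Finset.prod_mul_distrib, mul_assoc,
    ← h, det_vandermonde, Finset.prod_range]
  simp [Fin.prod_Ioi_succ]

end Matrix

lemma C2_natCast_s17 (n : ℕ) : C2 n = n.choose 2 := by
  have h : ((n : ℤ) * (n - 1) / 2) = (n.choose 2 : ℕ) := by
    rw [Nat.choose_two_right]
    cases n <;> simp
  rw [C2, h, Int.toNat_natCast]

lemma choose_two_add (i j : ℕ) : (i + j).choose 2 = i.choose 2 + j.choose 2 + i * j := by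
  induction j with
  | zero => simp
  | succ j ih =>
    rw [← add_assoc, Nat.choose_succ_succ' (i + j) 1, Nat.choose_succ_succ' j 1, ih]
    simp only [Nat.choose_one_right]
    ring

lemma ddR_zero_eq (n : ℕ) :
    ddR 0 n = (∏ i ∈ range n, (RatFunc.X : RatFunc ℚ) ^ i.choose 2) ^ 2 *
      (Matrix.vandermonde fun i : Fin n => (RatFunc.X : RatFunc ℚ) ^ (i : ℕ)).det := by
  rw [sq, mul_assoc, prod_range, ← Matrix.det_mul_row, ← Matrix.det_mul_column, ddR]
  congr 1
  ext i j
  simp only [Matrix.of_apply, Matrix.vandermonde_apply]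
  rw [zero_add, ← Nat.cast_add, C2_natCast_s17, choose_two_add]
  ring

lemma ddR_zero_succ (n : ℕ) :
    ddR 0 (n + 1) = (RatFunc.X ^ n.choose 2) ^ 2 *
      (∏ j ∈ range n, ((RatFunc.X ^ (j + 1) - 1) * RatFunc.X ^ j)) * ddR 0 n := by
  rw [ddR_zero_eq, ddR_zero_eq, Matrix.det_vandermonde_pow_succ, prod_range_succ]
  ring

lemma ratFunc_X_pow_injective : Function.Injective fun n : ℕ => (RatFunc.X : RatFunc ℚ) ^ n := by
  intro a b h
  simp only [← RatFunc.algebraMap_X, ← map_pow] at h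
  simpa using congrArg natDegree (RatFunc.algebraMap_injective ℚ h)

lemma ddR_zero_ne_zero (n : ℕ) : ddR 0 n ≠ 0 := by
  rw [ddR_zero_eq]
  refine mul_ne_zero (pow_ne_zero _ (prod_ne_zero_iff.2 fun i _ => pow_ne_zero _ RatFunc.X_ne_zero))
    (Matrix.det_vandermonde_ne_zero_iff.2 ?_)
  exact ratFunc_X_pow_injective.comp Fin.val_injective

lemma ddR_zero_mul_ddR_zero (n : ℕ) :
    ddR 0 (n + 2) * ddR 0 n =
      (RatFunc.X ^ (n + 1) - 1) * RatFunc.X ^ (3 * n) * ddR 0 (n + 1) ^ 2 := by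
  rw [ddR_zero_succ (n + 1), ddR_zero_succ n, prod_range_succ, choose_two_add n 1]
  simp
  ring

/-- Dodgson condensation for the Hankel determinants `DDR`. -/
lemma DDR_condensation (m : ℤ) (n : ℕ) :
    DDR m (n + 2) * DDR (m + 2) n =
      DDR (m + 2) (n + 1) * DDR m (n + 1) - DDR (m + 1) (n + 1) ^ 2 := by
  have h := Matrix.det_mul_det_submatrix_inner
    (Matrix.of fun i j : Fin (n + 2) => aR (m + (i : ℤ) + (j : ℤ)))
  rw [sq]
  convert h using 3 <;>
  · refine congrArg Matrix.det (Matrix.ext fun i j => congrArg aR ?_)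
    simp only [Fin.val_succ, Fin.val_castSucc] <;> omega

/-- `r_{m,n} (q^n-1) q^{m+n+1} r_{m+2,n-2} = r_{m,n-1} r_{m+2,n-1} - r_{m+1,n-1}^2`
for `n ≥ 2`. -/
theorem stmt17 (m n : ℕ) (hn : 2 ≤ n) :
    rr m n * ((RatFunc.X ^ n - 1) * RatFunc.X ^ (m + n + 1) * rr (m + 2) (n - 2)) =
      rr m (n - 1) * rr (m + 2) (n - 1) - rr (m + 1) (n - 1) ^ 2 := by
  obtain ⟨k, rfl⟩ := Nat.exists_eq_add_of_le' hn
  have hX : (RatFunc.X : RatFunc ℚ) ≠ 0 := RatFunc.X_ne_zero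
  have hD := DDR_condensation (-((m + 2 : ℕ) : ℤ)) (m + k + 2)
  have e₂ : -((m + 2 : ℕ) : ℤ) + 2 = -(m : ℤ) := by push_cast; ring
  have e₁ : -((m + 2 : ℕ) : ℤ) + 1 = -((m + 1 : ℕ) : ℤ) := by push_cast; ring
  rw [e₁, e₂] at hD
  have hd := ddR_zero_mul_ddR_zero (k + 1)
  have h₁ := ddR_zero_ne_zero (k + 1)
  have h₂ := ddR_zero_ne_zero (k + 2)
  have h₃ := ddR_zero_ne_zero (k + 3)
  have hx : (RatFunc.X : RatFunc ℚ) ^ (k + 2) - 1 ≠ 0 := by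
    intro h
    rw [show k + 1 + 1 = k + 2 by ring, h, zero_mul, zero_mul] at hd
    exact mul_ne_zero h₃ h₁ hd
  have hd₃ : ddR 0 (k + 3) = (RatFunc.X ^ (k + 2) - 1) * RatFunc.X ^ (3 * (k + 1)) *
      ddR 0 (k + 2) ^ 2 / ddR 0 (k + 1) := by
    rw [eq_div_iff h₁]
    exact hd
  have hs : ((-1 : RatFunc ℚ) ^ (m + 1).choose 2) ^ 2 = 1 := by rw [← pow_mul]; simp
  have ht : ((-1 : RatFunc ℚ) ^ (m + 1)) ^ 2 = 1 := by rw [← pow_mul]; simp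
  have r₁ : rr m (k + 2) = (-1) ^ (m + 1).choose 2 * DDR (-(m : ℤ)) (m + k + 2 + 1) /
      (RatFunc.X ^ (m * k.choose 2) * RatFunc.X ^ m * (RatFunc.X ^ (m * k)) ^ 2 *
        ddR 0 (k + 3)) := by
    rw [rr, choose_two_add k 2, Nat.choose_self]
    ring_nf
  have r₂ : rr (m + 2) k = -((-1) ^ (m + 1).choose 2) *
      DDR (-((m + 2 : ℕ) : ℤ)) (m + k + 2 + 1) /
      (RatFunc.X ^ (m * k.choose 2) * (RatFunc.X ^ k.choose 2) ^ 2 * ddR 0 (k + 1)) := by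
    rw [rr, show m + 2 + 1 = m + 1 + 2 by ring, choose_two_add (m + 1) 2, pow_add, pow_mul,
      Nat.choose_self, pow_add, pow_mul, ht, show m + 2 + k + 1 = m + k + 2 + 1 by ring]
    ring_nf
  have r₃ : rr m (k + 1) = (-1) ^ (m + 1).choose 2 * DDR (-(m : ℤ)) (m + k + 2) /
      (RatFunc.X ^ (m * k.choose 2) * RatFunc.X ^ (m * k) * ddR 0 (k + 2)) := by
    rw [rr, choose_two_add k 1, Nat.choose_eq_zero_of_lt one_lt_two]
    ring_nf
  have r₄ : rr (m + 2) (k + 1) = -((-1) ^ (m + 1).choose 2) *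
      DDR (-((m + 2 : ℕ) : ℤ)) (m + k + 2 + 2) /
      (RatFunc.X ^ (m * k.choose 2) * (RatFunc.X ^ k.choose 2) ^ 2 * RatFunc.X ^ (m * k) *
        (RatFunc.X ^ k) ^ 2 * ddR 0 (k + 2)) := by
    rw [rr, show m + 2 + 1 = m + 1 + 2 by ring, choose_two_add (m + 1) 2, pow_add, pow_mul,
      Nat.choose_self, pow_add, pow_mul, ht, show m + 2 + (k + 1) + 1 = m + k + 2 + 2 by ring,
      choose_two_add k 1, Nat.choose_eq_zero_of_lt one_lt_two]
    ring_nf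
  have r₅ : rr (m + 1) (k + 1) = (-1) ^ (m + 1).choose 2 * (-1) ^ (m + 1) *
      DDR (-((m + 1 : ℕ) : ℤ)) (m + k + 2 + 1) /
      (RatFunc.X ^ (m * k.choose 2) * RatFunc.X ^ k.choose 2 * RatFunc.X ^ (m * k) *
        RatFunc.X ^ k * ddR 0 (k + 2)) := by
    rw [rr, choose_two_add (m + 1) 1, show m + 1 + (k + 1) + 1 = m + k + 2 + 1 by ring,
      choose_two_add k 1, Nat.choose_eq_zero_of_lt one_lt_two]
    ring_nf
  rw [show k + 2 - 2 = k by omega, show k + 2 - 1 = k + 1 by omega, r₁, r₂, r₃, r₄, r₅, hd₃,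
    show m + (k + 2) + 1 = m + k + 3 by ring, pow_add _ (m + k) 3, pow_add _ m k,
    show 3 * (k + 1) = k * 3 + 3 by ring, pow_add _ (k * 3) 3, pow_mul _ k 3]
  generalize ddR 0 (k + 1) = d₁ at *
  generalize ddR 0 (k + 2) = d₂ at *
  generalize (RatFunc.X : RatFunc ℚ) ^ (k + 2) - 1 = x at *
  have n₁ := pow_ne_zero (m * k.choose 2) hX
  have n₂ := pow_ne_zero (k.choose 2) hX
  have n₃ := pow_ne_zero (m * k) hX
  have n₄ := pow_ne_zero k hX
  have n₅ := pow_ne_zero m hX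
  generalize (RatFunc.X : RatFunc ℚ) ^ (m * k.choose 2) = y₁ at *
  generalize (RatFunc.X : RatFunc ℚ) ^ k.choose 2 = y₂ at *
  generalize (RatFunc.X : RatFunc ℚ) ^ (m * k) = y₃ at *
  generalize (RatFunc.X : RatFunc ℚ) ^ k = y₄ at *
  generalize (RatFunc.X : RatFunc ℚ) ^ m = y₅ at *
  generalize (-1 : RatFunc ℚ) ^ (m + 1).choose 2 = s at *
  generalize (-1 : RatFunc ℚ) ^ (m + 1) = t at *
  field_simp
  rw [hs, ht]
  linear_combination hD
end
end

section
/- For every integer n ≥ 1, q^n · u(n,q) = ∑_{k=0}^{n−1} (−1)^{n−k} ⟨n−1, k⟩_q in ℤ[q]. -/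
open Polynomial Finset

noncomputable section

theorem eq_zero_of_le_of_recurrence {R : Type*} [CommRing R] {c : ℕ → R} {A : ℕ → ℕ → R}
    (hA1 : ∀ k : ℕ, 1 ≤ k → A 0 k = 0)
    (hA2 : ∀ n k : ℕ, 1 ≤ k →
      A (n + 1) k = ∑ j ∈ Finset.range (min n k + 1), c j * A (n - j) (k - j))
    (n k : ℕ) (hk : 1 ≤ k) (hnk : n ≤ k) : A n k = 0 := by
  induction n using Nat.strong_induction_on generalizing k with
  | _ n ih =>
    rcases n with _ | n
    · exact hA1 k hk
    · rw [hA2 n k hk]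
      refine Finset.sum_eq_zero fun j hj => ?_
      have hj := Finset.mem_range.mp hj
      rw [ih (n - j) (by omega) (k - j) (by omega) (by omega), mul_zero]

/-- The alternating row sums of a triangle defined by a diagonal convolution recurrence
satisfy the corresponding one-dimensional convolution recurrence. -/
theorem alternating_sum_succ_of_recurrence {R : Type*} [CommRing R] {c : ℕ → R}
    {A : ℕ → ℕ → R}
    (hA : ∀ n k : ℕ,
      A (n + 1) k = ∑ j ∈ Finset.range (min n k + 1), c j * A (n - j) (k - j)) (n : ℕ) :
    ∑ k ∈ Finset.range (n + 1), (-1) ^ (n + 1 - k) * A (n + 1) k =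
      -∑ j ∈ Finset.range (n + 1),
        c j * ∑ k ∈ Finset.range (n - j + 1), (-1) ^ (n - j - k) * A (n - j) k := by
  have hrow : ∀ k ∈ Finset.range (n + 1), (-1) ^ (n + 1 - k) * A (n + 1) k =
      ∑ j ∈ Finset.range (n + 1),
        if j ≤ k then (-1) ^ (n + 1 - k) * (c j * A (n - j) (k - j)) else 0 := by
    intro k hk
    have hk := Finset.mem_range.mp hk
    rw [hA n k, Finset.mul_sum, ← Finset.sum_filter]
    refine Finset.sum_congr ?_ fun _ _ => rfl
    ext j
    simp only [Finset.mem_range, Finset.mem_filter]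
    omega
  rw [Finset.sum_congr rfl hrow, Finset.sum_comm, ← Finset.sum_neg_distrib]
  refine Finset.sum_congr rfl fun j hj => ?_
  have hj := Finset.mem_range.mp hj
  obtain ⟨m, rfl⟩ : ∃ m, n = j + m := ⟨n - j, by omega⟩
  rw [show j + m + 1 = j + (m + 1) by ring, Finset.sum_range_add, Finset.sum_eq_zero, zero_add,
    Finset.mul_sum, ← Finset.sum_neg_distrib]
  · simp only [Nat.add_sub_cancel_left]
    refine Finset.sum_congr rfl fun i hi => ?_
    have hi := Finset.mem_range.mp hi
    rw [if_pos (by omega), show j + (m + 1) - (j + i) = m - i + 1 by omega, pow_succ]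
    ring
  · intro k hk
    have hk := Finset.mem_range.mp hk
    exact if_neg (by omega)

/-- If `u` is the reciprocal sequence of `q ^ C(n,2)`, then `q ^ n * u n` is determined by a
convolution recurrence with weights `q ^ C(j+2,2)`. -/
theorem pow_succ_mul_reciprocal_succ {R : Type*} [CommRing R] {q : R} {u : ℕ → R}
    (hu : ∀ n : ℕ, 1 ≤ n → ∑ j ∈ Finset.range (n + 1), q ^ (j.choose 2) * u (n - j) = 0)
    (n : ℕ) :
    q ^ (n + 1) * u (n + 1) =
      -∑ j ∈ Finset.range (n + 1), q ^ ((j + 2).choose 2) * (q ^ (n - j) * u (n - j)) := by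
  have h := congrArg (q ^ (n + 1) * ·) (hu (n + 1) (by omega))
  simp only [mul_zero, Finset.sum_range_succ' _ (n + 1), mul_add, Finset.mul_sum] at h
  simp only [Nat.choose_zero_succ, pow_zero, one_mul, Nat.sub_zero] at h
  rw [eq_neg_iff_add_eq_zero, add_comm, ← h]
  congr 1
  refine Finset.sum_congr rfl fun j hj => ?_
  have hj := Finset.mem_range.mp hj
  rw [Nat.add_sub_add_right, ← mul_assoc, ← mul_assoc, ← pow_add, ← pow_add]
  congr 2
  have : (j + 2).choose 2 = (j + 1).choose 1 + (j + 1).choose 2 := Nat.choose_succ_succ' (j + 1) 1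
  rw [Nat.choose_one_right] at this
  omega

/-- `q^n u(n,q) = ∑_{k=0}^{n-1} (-1)^{n-k} ⟨n-1, k⟩_q` for `n ≥ 1`, where `A n k`
denotes `⟨n-1, k⟩_q` and `u` is the reciprocal sequence of `(q^{C(n,2)})_{n≥0}`. -/
theorem stmt19 (u : ℕ → Polynomial ℤ) (hu0 : u 0 = 1)
    (hu : ∀ n : ℕ, 1 ≤ n → ∑ j ∈ Finset.range (n + 1), X ^ (j.choose 2) * u (n - j) = 0)
    (A : ℕ → ℕ → Polynomial ℤ)
    (hA0 : ∀ n : ℕ, A n 0 = X ^ n)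
    (hA1 : ∀ k : ℕ, 1 ≤ k → A 0 k = 0)
    (hA2 : ∀ n k : ℕ, 1 ≤ k →
      A (n + 1) k = ∑ j ∈ Finset.range (min n k + 1), X ^ ((j + 2).choose 2) * A (n - j) (k - j))
    (n : ℕ) (hn : 1 ≤ n) :
    X ^ n * u n = ∑ k ∈ Finset.range n, (-1) ^ (n - k) * A n k := by
  have hA : ∀ n k : ℕ, A (n + 1) k =
      ∑ j ∈ Finset.range (min n k + 1), X ^ ((j + 2).choose 2) * A (n - j) (k - j) := by
    intro n k
    rcases Nat.eq_zero_or_pos k with rfl | hk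
    · simp [hA0, pow_succ']
    · exact hA2 n k hk
  have hsum : ∀ n : ℕ, X ^ n * u n = ∑ k ∈ Finset.range (n + 1), (-1) ^ (n - k) * A n k := by
    intro n
    induction n using Nat.strong_induction_on with
    | _ n ih =>
      rcases n with _ | n
      · simp [hu0, hA0]
      · rw [Finset.sum_range_succ,
          eq_zero_of_le_of_recurrence hA1 hA2 (n + 1) (n + 1) (by omega) le_rfl, mul_zero,
          add_zero, alternating_sum_succ_of_recurrence hA, pow_succ_mul_reciprocal_succ hu]
        congr 1
        exact Finset.sum_congr rfl fun j _ => by rw [ih (n - j) (by omega)]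
  rw [hsum n, Finset.sum_range_succ, eq_zero_of_le_of_recurrence hA1 hA2 n n hn le_rfl, mul_zero,
    add_zero]
end
end
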